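/- Let R be a left GF-closed ring with l.Gwdim(R) < ∞ and let n be a positive integer. Then l.Gwdim(R) ≤ n if and only if fd_R(E) ≤ n for every injective right R-module E. -/

import Mathlib

/-!
Background definitions for D. Bennis, "Weak Gorenstein global dimensions".

Conventions.  All rings are associative with identity.  A *left* `R`-module is a type with
`[AddCommGroup M] [Module R M]`; a *right* `R`-module is a left module over the opposite ring,
i.e. `[Module Rᵐᵒᵖ M]`.  All "right-handed" notions below are obtained by applying the
corresponding "left-handed" notion to the opposite ring `Rᵐᵒᵖ`.
-/

open MulOpposite

universe u

section Tensor

variable (S : Type u) [Ring S]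

/-- The subgroup of relations defining the tensor product `A ⊗_S M` of a right `S`-module `A`
and a left `S`-module `M` over a (possibly noncommutative) ring `S`. -/
def tensorRels (A : Type u) [AddCommGroup A] [Module Sᵐᵒᵖ A]
    (M : Type u) [AddCommGroup M] [Module S M] :
    AddSubgroup (FreeAbelianGroup (A × M)) :=
  AddSubgroup.closure
    { x | (∃ a₁ a₂ m, x = FreeAbelianGroup.of (a₁ + a₂, m) - FreeAbelianGroup.of (a₁, m) -
            FreeAbelianGroup.of (a₂, m)) ∨
          (∃ a m₁ m₂, x = FreeAbelianGroup.of (a, m₁ + m₂) - FreeAbelianGroup.of (a, m₁) -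
            FreeAbelianGroup.of (a, m₂)) ∨
          (∃ (a : A) (r : S) (m : M), x = FreeAbelianGroup.of (op r • a, m) - FreeAbelianGroup.of (a, r • m)) }

/-- The tensor product `A ⊗_S M` (an abelian group) of a right `S`-module `A` and a left
`S`-module `M` over a (possibly noncommutative) ring `S`. -/
def NTensor (A : Type u) [AddCommGroup A] [Module Sᵐᵒᵖ A]
    (M : Type u) [AddCommGroup M] [Module S M] : Type u :=
  FreeAbelianGroup (A × M) ⧸ tensorRels S A M

instance (A : Type u) [AddCommGroup A] [Module Sᵐᵒᵖ A]
    (M : Type u) [AddCommGroup M] [Module S M] : AddCommGroup (NTensor S A M) :=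
  QuotientAddGroup.Quotient.addCommGroup _

namespace NTensor

variable {S}
variable {A A' : Type u} [AddCommGroup A] [Module Sᵐᵒᵖ A] [AddCommGroup A'] [Module Sᵐᵒᵖ A']
variable {M M' : Type u} [AddCommGroup M] [Module S M] [AddCommGroup M'] [Module S M']

/-- Functoriality of `A ⊗_S −` : the map `A ⊗_S M → A ⊗_S M'` induced by a linear map
`g : M → M'` of left `S`-modules. -/
def rmap (A : Type u) [AddCommGroup A] [Module Sᵐᵒᵖ A] (g : M →ₗ[S] M') :
    NTensor S A M →+ NTensor S A M' :=
  QuotientAddGroup.map (tensorRels S A M) (tensorRels S A M') (FreeAbelianGroup.map (Prod.map id g)) (by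
    simp only [tensorRels]
    refine (AddSubgroup.closure_le _).2 ?_
    rintro x (⟨a₁, a₂, m, rfl⟩ | ⟨a, m₁, m₂, rfl⟩ | ⟨a, r, m, rfl⟩) <;>
      refine SetLike.mem_coe.2 (AddSubgroup.mem_comap.2 (AddSubgroup.subset_closure ?_)) <;>
      simp only [map_sub, map_add, map_smul, FreeAbelianGroup.map_of_apply, Prod.map_apply,
        id_eq, Set.mem_setOf_eq]
    · exact Or.inl ⟨a₁, a₂, g m, rfl⟩
    · exact Or.inr (Or.inl ⟨a, g m₁, g m₂, rfl⟩)
    · exact Or.inr (Or.inr ⟨a, r, g m, rfl⟩))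

/-- Functoriality of `− ⊗_S M` : the map `A ⊗_S M → A' ⊗_S M` induced by a linear map
`f : A → A'` of right `S`-modules. -/
def lmap (M : Type u) [AddCommGroup M] [Module S M] (f : A →ₗ[Sᵐᵒᵖ] A') :
    NTensor S A M →+ NTensor S A' M :=
  QuotientAddGroup.map (tensorRels S A M) (tensorRels S A' M) (FreeAbelianGroup.map (Prod.map f id)) (by
    simp only [tensorRels]
    refine (AddSubgroup.closure_le _).2 ?_
    rintro x (⟨a₁, a₂, m, rfl⟩ | ⟨a, m₁, m₂, rfl⟩ | ⟨a, r, m, rfl⟩) <;>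
      refine SetLike.mem_coe.2 (AddSubgroup.mem_comap.2 (AddSubgroup.subset_closure ?_)) <;>
      simp only [map_sub, map_add, map_smul, FreeAbelianGroup.map_of_apply, Prod.map_apply,
        id_eq, Set.mem_setOf_eq]
    · exact Or.inl ⟨f a₁, f a₂, m, rfl⟩
    · exact Or.inr (Or.inl ⟨f a, m₁, m₂, rfl⟩)
    · exact Or.inr (Or.inr ⟨f a, r, m, rfl⟩))

end NTensor

end Tensor

section Dims

variable (S : Type u) [Ring S]

/-- A left `S`-module `M` is *flat* if tensoring with it preserves injectivity of maps of
right `S`-modules. -/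
def IsFlatMod (M : ModuleCat.{u} S) : Prop :=
  ∀ (A B : Type u) [AddCommGroup A] [Module Sᵐᵒᵖ A] [AddCommGroup B] [Module Sᵐᵒᵖ B]
    (f : A →ₗ[Sᵐᵒᵖ] B), Function.Injective f →
      Function.Injective (NTensor.lmap (↥M) f)

/-- A left `S`-module `M` is *Gorenstein flat* if there is an exact sequence
`⋯ → F (-1) → F 0 → F 1 → ⋯` of flat left `S`-modules with `M ≅ Im (F 0 → F 1)` which stays
exact after applying `I ⊗_S −` for every injective right `S`-module `I`
(a *complete flat resolution*). -/
def IsGorensteinFlat (M : ModuleCat.{u} S) : Prop :=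
  ∃ (F : ℤ → ModuleCat.{u} S) (d : ∀ n : ℤ, ↥(F n) →ₗ[S] ↥(F (n + 1))),
    (∀ n, IsFlatMod S (F n)) ∧
    (∀ n, Function.Exact (d n) (d (n + 1))) ∧
    Nonempty (↥M ≃ₗ[S] ↥(LinearMap.range (d 0))) ∧
    (∀ (I : Type u) [AddCommGroup I] [Module Sᵐᵒᵖ I], Module.Injective Sᵐᵒᵖ I →
      ∀ n, Function.Exact (NTensor.rmap I (d n)) (NTensor.rmap I (d (n + 1))))

/-- `gflatDimLE S n M` means `Gfd_S(M) ≤ n`: there is an exact sequence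
`0 → G_n → ⋯ → G_0 → M → 0` of left `S`-modules with all `G_i` Gorenstein flat. -/
def gflatDimLE : ℕ → ModuleCat.{u} S → Prop
  | 0, M => IsGorensteinFlat S M
  | n + 1, M => ∃ (K G : ModuleCat.{u} S) (ι : ↥K →ₗ[S] ↥G) (π : ↥G →ₗ[S] ↥M),
      Function.Injective ι ∧ Function.Surjective π ∧ Function.Exact ι π ∧
      IsGorensteinFlat S G ∧ gflatDimLE n K

/-- `flatDimLE S n M` means `fd_S(M) ≤ n`: there is an exact sequence
`0 → F_n → ⋯ → F_0 → M → 0` of left `S`-modules with all `F_i` flat. -/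
def flatDimLE : ℕ → ModuleCat.{u} S → Prop
  | 0, M => IsFlatMod S M
  | n + 1, M => ∃ (K F : ModuleCat.{u} S) (ι : ↥K →ₗ[S] ↥F) (π : ↥F →ₗ[S] ↥M),
      Function.Injective ι ∧ Function.Surjective π ∧ Function.Exact ι π ∧
      IsFlatMod S F ∧ flatDimLE n K

/-- `injDimLE S n M` means `id_S(M) ≤ n`: there is an exact sequence
`0 → M → I^0 → ⋯ → I^n → 0` of left `S`-modules with all `I^i` injective. -/
def injDimLE : ℕ → ModuleCat.{u} S → Prop
  | 0, M => Module.Injective S ↥M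
  | n + 1, M => ∃ (I C : ModuleCat.{u} S) (ι : ↥M →ₗ[S] ↥I) (π : ↥I →ₗ[S] ↥C),
      Function.Injective ι ∧ Function.Surjective π ∧ Function.Exact ι π ∧
      Module.Injective S ↥I ∧ injDimLE n C

/-- The Gorenstein flat dimension `Gfd_S(M) ∈ ℕ∞` of a left `S`-module `M`. -/
noncomputable def gflatDim (M : ModuleCat.{u} S) : ℕ∞ :=
  sInf {d : ℕ∞ | ∃ n : ℕ, d = n ∧ gflatDimLE S n M}

/-- The flat dimension `fd_S(M) ∈ ℕ∞` of a left `S`-module `M`. -/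
noncomputable def flatDim (M : ModuleCat.{u} S) : ℕ∞ :=
  sInf {d : ℕ∞ | ∃ n : ℕ, d = n ∧ flatDimLE S n M}

/-- The injective dimension `id_S(M) ∈ ℕ∞` of a left `S`-module `M`. -/
noncomputable def injDim (M : ModuleCat.{u} S) : ℕ∞ :=
  sInf {d : ℕ∞ | ∃ n : ℕ, d = n ∧ injDimLE S n M}

/-- The left weak Gorenstein global dimension
`l.Gwdim(S) = sup { Gfd_S(M) | M a left S-module }`.  The right weak Gorenstein global
dimension of `S` is `gorensteinWeakGlobalDim Sᵐᵒᵖ`. -/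
noncomputable def gorensteinWeakGlobalDim : ℕ∞ :=
  ⨆ M : ModuleCat.{u} S, gflatDim S M

/-- The left weak global dimension `sup { fd_S(M) | M a left S-module }`.  (By a classical
theorem it agrees with `weakGlobalDim Sᵐᵒᵖ`, and the common value is `wdim S`.) -/
noncomputable def weakGlobalDim : ℕ∞ :=
  ⨆ M : ModuleCat.{u} S, flatDim S M

/-- The left finitistic flat dimension
`l.FFD(S) = sup { fd_S(M) | M a left S-module with fd_S(M) < ∞ }`. -/
noncomputable def finitisticFlatDim : ℕ∞ :=
  sSup {d : ℕ∞ | d ≠ ⊤ ∧ ∃ M : ModuleCat.{u} S, flatDim S M = d}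

/-- The left finitistic Gorenstein flat dimension
`l.FGFD(S) = sup { Gfd_S(M) | M a left S-module with Gfd_S(M) < ∞ }`. -/
noncomputable def finitisticGFlatDim : ℕ∞ :=
  sSup {d : ℕ∞ | d ≠ ⊤ ∧ ∃ M : ModuleCat.{u} S, gflatDim S M = d}

/-- A ring `S` is *left GF-closed* if the class of Gorenstein flat left `S`-modules is closed
under extensions.  `S` is right GF-closed iff `Sᵐᵒᵖ` is left GF-closed, and GF-closed if both. -/
def IsGFClosed : Prop :=
  ∀ (A B C : ModuleCat.{u} S) (f : ↥A →ₗ[S] ↥B) (g : ↥B →ₗ[S] ↥C),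
    Function.Injective f → Function.Surjective g → Function.Exact f g →
      IsGorensteinFlat S A → IsGorensteinFlat S C → IsGorensteinFlat S B

/-- A ring `S` is *left coherent* if every finitely generated left ideal of `S` is finitely
presented (as a left `S`-module).  `S` is right coherent iff `Sᵐᵒᵖ` is left coherent. -/
def IsLeftCoherent : Prop :=
  ∀ I : Submodule S S, I.FG → Module.FinitePresentation S ↥I

/-- A ring `S` is *left IF* if every injective left `S`-module is flat.  `S` is right IF iff
`Sᵐᵒᵖ` is left IF, and IF if both. -/
def IsLeftIF : Prop :=
  ∀ E : ModuleCat.{u} S, Module.Injective S ↥E → IsFlatMod S E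

/-- A ring `S` is *left `n`-IF* if `fd_S(E) ≤ n` for every injective left `S`-module `E`.
`S` is right `n`-IF iff `Sᵐᵒᵖ` is left `n`-IF, and `n`-IF if both. -/
def IsLeftNIF (n : ℕ) : Prop :=
  ∀ E : ModuleCat.{u} S, Module.Injective S ↥E → flatDim S E ≤ (n : ℕ∞)

/-- `Ext¹_S(T, K) = 0`, expressed by its standard characterization: every extension of `T`
by `K` (i.e. every short exact sequence `0 → K → X → T → 0`) splits. -/
def Ext1Zero (T K : ModuleCat.{u} S) : Prop :=
  ∀ (X : ModuleCat.{u} S) (ι : ↥K →ₗ[S] ↥X) (π : ↥X →ₗ[S] ↥T),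
    Function.Injective ι → Function.Surjective π → Function.Exact ι π →
      ∃ ρ : ↥X →ₗ[S] ↥K, ρ.comp ι = LinearMap.id

/-- A left `S`-module `K` is *cotorsion* if `Ext¹_S(F, K) = 0` for every flat left
`S`-module `F`. -/
def IsCotorsion (K : ModuleCat.{u} S) : Prop :=
  ∀ F : ModuleCat.{u} S, IsFlatMod S F → Ext1Zero S F K

/-- `Tor₁^S(A, T) = 0` for a right `S`-module `A` and a left `S`-module `T`, expressed by its
standard characterization: for every short exact sequence `0 → K → F → T → 0` of left
`S`-modules with `F` flat, the induced map `A ⊗_S K → A ⊗_S F` is injective. -/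
def Tor1Zero (A : Type u) [AddCommGroup A] [Module Sᵐᵒᵖ A] (T : ModuleCat.{u} S) : Prop :=
  ∀ (K F : ModuleCat.{u} S) (ι : ↥K →ₗ[S] ↥F) (π : ↥F →ₗ[S] ↥T),
    IsFlatMod S F → Function.Injective ι → Function.Surjective π → Function.Exact ι π →
      Function.Injective (NTensor.rmap A ι)

/-- A left `S`-module is *finitely presented* if it admits a presentation with finitely many
generators and relations. -/
abbrev IsFinitelyPresented (M : ModuleCat.{u} S) : Prop :=
  Module.FinitePresentation S ↥M

end Dims

section CharacterDuality

/-- A sequence of additive groups is exact iff its sequence of character groups is. -/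
lemma exact_iff_characters {X Y Z : Type u} [AddCommGroup X] [AddCommGroup Y] [AddCommGroup Z]
    (f : X →+ Y) (g : Y →+ Z) :
    Function.Exact f g ↔ ∀ ψ : Y →+ AddCircle (1 : ℚ),
      ψ.comp f = 0 ↔ ∃ χ : Z →+ AddCircle (1 : ℚ), χ.comp g = ψ := by
  constructor
  · intro hfg ψ
    constructor
    · intro hψ
      have hker : ∀ y ∈ g.ker, ψ y = 0 := by
        intro y hy
        obtain ⟨x, rfl⟩ := (hfg y).1 hy
        exact DFunLike.congr_fun hψ x
      obtain ⟨χ, hχ⟩ := (Module.Baer.of_divisible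
        (AddCircle (1 : ℚ))).extension_property_addMonoidHom
        (QuotientAddGroup.kerLift g) (QuotientAddGroup.kerLift_injective g)
        (QuotientAddGroup.lift g.ker ψ hker)
      refine ⟨χ, AddMonoidHom.ext fun y => ?_⟩
      exact DFunLike.congr_fun hχ (QuotientAddGroup.mk y)
    · rintro ⟨χ, rfl⟩
      ext x
      have : g (f x) = 0 := (hfg (f x)).2 ⟨x, rfl⟩
      simp [this]
  · intro hchar y
    constructor
    · intro hy
      by_contra hne
      have hmk : (QuotientAddGroup.mk y : Y ⧸ f.range) ≠ 0 := fun h0 =>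
        hne ((QuotientAddGroup.eq_zero_iff y).1 h0)
      obtain ⟨c, hc⟩ := CharacterModule.exists_character_apply_ne_zero_of_ne_zero hmk
      let c' : (Y ⧸ f.range) →+ AddCircle (1 : ℚ) := c
      obtain ⟨χ, hχ⟩ := (hchar (c'.comp (QuotientAddGroup.mk' f.range))).1 (by
        ext x
        have : (QuotientAddGroup.mk (f x) : Y ⧸ f.range) = 0 :=
          (QuotientAddGroup.eq_zero_iff _).2 ⟨x, rfl⟩
        simp [this])
      refine hc ?_
      have := DFunLike.congr_fun hχ y
      simp only [AddMonoidHom.comp_apply, hy, map_zero] at this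
      exact this.symm
    · rintro ⟨x, rfl⟩
      refine CharacterModule.eq_zero_of_character_apply fun c => ?_
      exact DFunLike.congr_fun ((hchar (AddMonoidHom.comp c g)).2 ⟨c, rfl⟩) x

lemma injective_iff_characters {X Y : Type u} [AddCommGroup X] [AddCommGroup Y] (f : X →+ Y) :
    Function.Injective f ↔ ∀ φ : X →+ AddCircle (1 : ℚ),
      ∃ ψ : Y →+ AddCircle (1 : ℚ), ψ.comp f = φ := by
  constructor
  · intro hf φ
    exact (Module.Baer.of_divisible _).extension_property_addMonoidHom f hf φ
  · intro hext
    refine (injective_iff_map_eq_zero f).2 fun x hx =>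
      CharacterModule.eq_zero_of_character_apply fun c => ?_
    obtain ⟨ψ, hψ⟩ := hext c
    have := DFunLike.congr_fun hψ x
    simp only [AddMonoidHom.comp_apply, hx, map_zero] at this
    exact this.symm

variable {S : Type u} [Ring S]

/-- The character module of a left module, as a right module. -/
instance characterModuleRight (M : Type u) [AddCommGroup M] [Module S M] :
    Module Sᵐᵒᵖ (CharacterModule M) where
  smul r c := AddMonoidHom.comp c (DistribSMul.toAddMonoidHom M (unop r))
  one_smul c := by ext m; exact congrArg c (one_smul S m)
  mul_smul r s c := by ext m; exact congrArg c (mul_smul (unop s) (unop r) m)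
  smul_zero _ := rfl
  smul_add _ _ _ := rfl
  add_smul r s c := by
    ext m; exact (congrArg c (add_smul (unop r) (unop s) m)).trans (map_add c _ _)
  zero_smul c := by ext m; exact (congrArg c (zero_smul S m)).trans (map_zero c)

/-- The character module of a right module, as a left module. -/
instance characterModuleLeft (A : Type u) [AddCommGroup A] [Module Sᵐᵒᵖ A] :
    Module S (CharacterModule A) where
  smul r c := AddMonoidHom.comp c (DistribSMul.toAddMonoidHom A (op r))
  one_smul c := by ext m; exact congrArg c (one_smul Sᵐᵒᵖ m)
  mul_smul r s c := by ext m; exact congrArg c (mul_smul (op s) (op r) m)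
  smul_zero _ := rfl
  smul_add _ _ _ := rfl
  add_smul r s c := by
    ext m; exact (congrArg c (add_smul (op r) (op s) m)).trans (map_add c _ _)
  zero_smul c := by ext m; exact (congrArg c (zero_smul Sᵐᵒᵖ m)).trans (map_zero c)

lemma characterModuleLeft_smul_apply {A : Type u} [AddCommGroup A] [Module Sᵐᵒᵖ A]
    (r : S) (c : CharacterModule A) (a : A) : (r • c) a = c (op r • a) := rfl

variable {A B : Type u} [AddCommGroup A] [Module Sᵐᵒᵖ A] [AddCommGroup B] [Module Sᵐᵒᵖ B]
variable {M N : Type u} [AddCommGroup M] [Module S M] [AddCommGroup N] [Module S N]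

/-- The map of left modules induced on characters by a map of right modules. -/
def characterMapLeft (f : A →ₗ[Sᵐᵒᵖ] B) : CharacterModule B →ₗ[S] CharacterModule A where
  toFun c := AddMonoidHom.comp c f.toAddMonoidHom
  map_add' _ _ := rfl
  map_smul' r c := by ext a; exact congrArg c (f.map_smul (op r) a).symm

/-- Exchange of the variables in a balanced pairing of `M` and `A` with values in `ℚ/ℤ`. -/
def characterFlip (φ : M →ₗ[S] CharacterModule A) : A →ₗ[Sᵐᵒᵖ] CharacterModule M where
  toFun a := (AddMonoidHom.mk' (fun m => φ m a) fun m m' => by rw [map_add]; rfl :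
    M →+ AddCircle (1 : ℚ))
  map_add' a b := by ext m; exact map_add (φ m) a b
  map_smul' r a := by
    ext m
    exact (DFunLike.congr_fun (φ.map_smul (unop r) m) a).symm

/-- The inverse of `characterFlip`. -/
def characterUnflip (φ : A →ₗ[Sᵐᵒᵖ] CharacterModule M) : M →ₗ[S] CharacterModule A where
  toFun m := (AddMonoidHom.mk' (fun a => φ a m) fun a b => by rw [map_add]; rfl :
    A →+ AddCircle (1 : ℚ))
  map_add' m m' := by ext a; exact map_add (φ a) m m'
  map_smul' r m := by
    ext a
    exact (DFunLike.congr_fun (φ.map_smul (op r) a) m).symm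

namespace NTensor

/-- The elementary tensor `a ⊗ m`. -/
def tmul (a : A) (m : M) : NTensor S A M :=
  QuotientAddGroup.mk' (tensorRels S A M) (FreeAbelianGroup.of (a, m))

lemma add_tmul (a b : A) (m : M) : (tmul (a + b) m : NTensor S A M) = tmul a m + tmul b m := by
  refine QuotientAddGroup.eq.2 (neg_mem_iff.1 (AddSubgroup.subset_closure (Or.inl ⟨a, b, m, ?_⟩)))
  change -(-FreeAbelianGroup.of (a + b, m) +
    (FreeAbelianGroup.of (a, m) + FreeAbelianGroup.of (b, m))) = _
  abel

lemma tmul_add (a : A) (m m' : M) : (tmul a (m + m') : NTensor S A M) = tmul a m + tmul a m' := by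
  refine QuotientAddGroup.eq.2
    (neg_mem_iff.1 (AddSubgroup.subset_closure (Or.inr (Or.inl ⟨a, m, m', ?_⟩))))
  change -(-FreeAbelianGroup.of (a, m + m') +
    (FreeAbelianGroup.of (a, m) + FreeAbelianGroup.of (a, m'))) = _
  abel

lemma smul_tmul (r : S) (a : A) (m : M) :
    (tmul (op r • a) m : NTensor S A M) = tmul a (r • m) := by
  refine QuotientAddGroup.eq.2
    (neg_mem_iff.1 (AddSubgroup.subset_closure (Or.inr (Or.inr ⟨a, r, m, ?_⟩))))
  abel

lemma hom_ext {φ ψ : NTensor S A M →+ AddCircle (1 : ℚ)}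
    (h : ∀ a m, φ (tmul a m) = ψ (tmul a m)) : φ = ψ := by
  refine QuotientAddGroup.addMonoidHom_ext _ (FreeAbelianGroup.lift_ext _ _ fun p => ?_)
  exact h p.1 p.2

/-- Linear maps into a character module are the characters of the tensor product. -/
def charEquiv : (M →ₗ[S] CharacterModule A) ≃ (NTensor S A M →+ AddCircle (1 : ℚ)) where
  toFun φ := QuotientAddGroup.lift (tensorRels S A M)
    (FreeAbelianGroup.lift fun p => φ p.2 p.1) (by
      intro x hx
      refine AddMonoidHom.mem_ker.1 (?_ : x ∈ AddMonoidHom.ker _)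
      refine (AddSubgroup.closure_le _).2 ?_ hx
      rintro x (⟨a₁, a₂, m, rfl⟩ | ⟨a, m₁, m₂, rfl⟩ | ⟨a, r, m, rfl⟩) <;>
        refine SetLike.mem_coe.2 (AddMonoidHom.mem_ker.2 ?_) <;>
        simp only [map_sub, FreeAbelianGroup.lift_apply_of, map_add, map_smul]
      · abel
      · rw [show (φ m₁ + φ m₂) a = φ m₁ a + φ m₂ a from rfl]; abel
      · rw [characterModuleLeft_smul_apply, sub_self])
  invFun χ :=
    { toFun m := (AddMonoidHom.mk' (fun a => χ (tmul a m)) fun a b => by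
          rw [add_tmul, map_add] : A →+ AddCircle (1 : ℚ))
      map_add' m m' := by
        ext a
        exact (congrArg χ (tmul_add a m m')).trans (map_add χ _ _)
      map_smul' r m := by
        ext a
        exact congrArg χ (smul_tmul r a m).symm }
  left_inv φ := by
    ext m a
    exact FreeAbelianGroup.lift_apply_of _ _
  right_inv χ := hom_ext fun a m => FreeAbelianGroup.lift_apply_of _ _

lemma charEquiv_comp_rmap (φ : N →ₗ[S] CharacterModule A) (g : M →ₗ[S] N) :
    (charEquiv φ).comp (rmap A g) = charEquiv (φ ∘ₗ g) := by
  refine hom_ext fun a m => ?_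
  exact (FreeAbelianGroup.lift_apply_of _ _).trans (FreeAbelianGroup.lift_apply_of _ _).symm

lemma charEquiv_comp_lmap (φ : M →ₗ[S] CharacterModule B) (f : A →ₗ[Sᵐᵒᵖ] B) :
    (charEquiv φ).comp (lmap M f) = charEquiv (characterMapLeft f ∘ₗ φ) := by
  refine hom_ext fun a m => ?_
  exact (FreeAbelianGroup.lift_apply_of _ _).trans (FreeAbelianGroup.lift_apply_of _ _).symm

lemma charEquiv_zero : charEquiv (0 : M →ₗ[S] CharacterModule A) = 0 :=
  hom_ext fun _ _ => FreeAbelianGroup.lift_apply_of _ _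

lemma rmap_exact_iff {L : Type u} [AddCommGroup L] [Module S L] (f : L →ₗ[S] M) (g : M →ₗ[S] N) :
    Function.Exact (rmap A f) (rmap A g) ↔ ∀ ψ : M →ₗ[S] CharacterModule A,
      ψ ∘ₗ f = 0 ↔ ∃ χ : N →ₗ[S] CharacterModule A, χ ∘ₗ g = ψ := by
  rw [exact_iff_characters]
  refine (charEquiv.forall_congr fun {ψ} => ?_).symm
  rw [charEquiv_comp_rmap, ← charEquiv_zero, charEquiv.apply_eq_iff_eq]
  refine iff_congr Iff.rfl (charEquiv.exists_congr fun χ => ?_)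
  rw [charEquiv_comp_rmap, charEquiv.apply_eq_iff_eq]

lemma lmap_injective_iff (f : A →ₗ[Sᵐᵒᵖ] B) :
    Function.Injective (lmap M f) ↔ ∀ φ : M →ₗ[S] CharacterModule A,
      ∃ ψ : M →ₗ[S] CharacterModule B, characterMapLeft f ∘ₗ ψ = φ := by
  rw [injective_iff_characters]
  refine (charEquiv.forall_congr fun {φ} => charEquiv.exists_congr fun ψ => ?_).symm
  rw [charEquiv_comp_lmap, charEquiv.apply_eq_iff_eq]

end NTensor

lemma isFlatMod_iff (M : ModuleCat.{u} S) :
    IsFlatMod S M ↔ ∀ (A B : Type u) [AddCommGroup A] [Module Sᵐᵒᵖ A] [AddCommGroup B]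
      [Module Sᵐᵒᵖ B] (f : A →ₗ[Sᵐᵒᵖ] B), Function.Injective f →
      ∀ φ : M →ₗ[S] CharacterModule A,
        ∃ ψ : M →ₗ[S] CharacterModule B, characterMapLeft f ∘ₗ ψ = φ := by
  simp only [IsFlatMod, NTensor.lmap_injective_iff]

/-- Lambek's criterion: a module is flat iff its character module is injective. -/
lemma isFlatMod_iff_injective_characterModule (M : ModuleCat.{u} S) :
    IsFlatMod S M ↔ Module.Injective Sᵐᵒᵖ (CharacterModule M) := by
  rw [isFlatMod_iff]
  constructor
  · intro hM
    refine ⟨fun A B _ _ _ _ f hf φ => ?_⟩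
    obtain ⟨ψ, hψ⟩ := hM A B f hf (characterUnflip φ)
    refine ⟨characterFlip ψ, fun a => ?_⟩
    ext m
    exact DFunLike.congr_fun (LinearMap.congr_fun hψ m) a
  · intro hM A B _ _ _ _ f hf φ
    obtain ⟨ψ, hψ⟩ := hM.out f hf (characterFlip φ)
    refine ⟨characterUnflip ψ, ?_⟩
    ext m a
    exact DFunLike.congr_fun (hψ a) m

end CharacterDuality

open CategoryTheory Abelian

section ShortExactSequences

/-- A short exact sequence `0 → A → B → C → 0` of modules. -/
structure IsShortExactSeq {S : Type u} [Ring S] {A B C : Type u} [AddCommGroup A] [Module S A]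
    [AddCommGroup B] [Module S B] [AddCommGroup C] [Module S C]
    (f : A →ₗ[S] B) (g : B →ₗ[S] C) : Prop where
  inj : Function.Injective f
  surj : Function.Surjective g
  exact : Function.Exact f g

variable {R : Type u} [Ring R]

lemma exists_isShortExactSeq_projective (M : ModuleCat.{u} R) :
    ∃ (K P : ModuleCat.{u} R) (ι : K →ₗ[R] P) (π : P →ₗ[R] M),
      IsShortExactSeq ι π ∧ Module.Projective R P := by
  let π : (M →₀ R) →ₗ[R] M := Finsupp.linearCombination R id
  refine ⟨ModuleCat.of R (LinearMap.ker π), ModuleCat.of R (M →₀ R), (LinearMap.ker π).subtype, π,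
    ⟨Subtype.val_injective, fun m => ⟨Finsupp.single m 1, by simp [π]⟩,
      LinearMap.exact_subtype_ker_map π⟩, inferInstanceAs (Module.Projective R (M →₀ R))⟩

lemma exists_isShortExactSeq_injective (A : ModuleCat.{u} R) :
    ∃ (E C : ModuleCat.{u} R) (ι : A →ₗ[R] E) (π : E →ₗ[R] C),
      IsShortExactSeq ι π ∧ Module.Injective R E := by
  let E := Injective.under A
  let ι : A →ₗ[R] E := (Injective.ι A).hom
  refine ⟨E, ModuleCat.of R (E ⧸ LinearMap.range ι), ι, (LinearMap.range ι).mkQ,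
    ⟨(ModuleCat.mono_iff_injective _).1 inferInstance, Submodule.mkQ_surjective _,
      LinearMap.exact_map_mkQ_range ι⟩,
      (Module.injective_iff_injective_object R E).2 (Injective.injective_under A)⟩

variable {A B C : ModuleCat.{u} R} {f : A →ₗ[R] B} {g : B →ₗ[R] C}

namespace IsShortExactSeq

lemma comp_eq_zero (h : IsShortExactSeq f g) : g ∘ₗ f = 0 := h.exact.linearMap_comp_eq_zero

lemma shortExact (h : IsShortExactSeq f g) :
    (ModuleCat.shortComplexOfCompEqZero f g h.comp_eq_zero).ShortExact :=
  ModuleCat.shortComplex_shortExact _ h.exact h.inj h.surj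

/-- Descent of a map vanishing on `A` along the surjection `B → C`. -/
lemma exists_desc (h : IsShortExactSeq f g) {N : Type u} [AddCommGroup N] [Module R N]
    (φ : B →ₗ[R] N) (hφ : φ ∘ₗ f = 0) : ∃ ψ : C →ₗ[R] N, ψ ∘ₗ g = φ := by
  have hker : LinearMap.ker g ≤ LinearMap.ker φ := by
    intro b hb
    obtain ⟨a, rfl⟩ := (h.exact b).1 hb
    exact LinearMap.congr_fun hφ a
  let e := g.quotKerEquivOfSurjective h.surj
  refine ⟨(LinearMap.ker g).liftQ φ hker ∘ₗ e.symm.toLinearMap, LinearMap.ext fun b => ?_⟩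
  have : e.symm (g b) = Submodule.Quotient.mk b := by
    rw [LinearEquiv.symm_apply_eq]; rfl
  simp [this]

variable (N : ModuleCat.{u} R)

lemma ext_right (h : IsShortExactSeq f g) {i : ℕ} (hA : Subsingleton (Ext A N i))
    (hB : Subsingleton (Ext B N (i + 1))) :
    Subsingleton (Ext C N (i + 1)) := by
  refine subsingleton_of_forall_eq 0 fun x => ?_
  obtain ⟨y, rfl⟩ := Ext.contravariant_sequence_exact₃ h.shortExact N x
    (@Subsingleton.elim _ hB _ _) (add_comm 1 i)
  rw [@Subsingleton.elim _ hA y 0, Ext.comp_zero]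

lemma ext_left (h : IsShortExactSeq f g) {i : ℕ} (hB : Subsingleton (Ext B N i))
    (hC : Subsingleton (Ext C N (i + 1))) :
    Subsingleton (Ext A N i) := by
  refine subsingleton_of_forall_eq 0 fun x => ?_
  obtain ⟨y, rfl⟩ := Ext.contravariant_sequence_exact₁ h.shortExact N x (add_comm 1 i)
    (@Subsingleton.elim _ hC _ _)
  rw [@Subsingleton.elim _ hB y 0, Ext.comp_zero]

lemma ext_mid (h : IsShortExactSeq f g) {i : ℕ} (hA : Subsingleton (Ext A N i))
    (hC : Subsingleton (Ext C N i)) :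
    Subsingleton (Ext B N i) := by
  refine subsingleton_of_forall_eq 0 fun x => ?_
  obtain ⟨y, rfl⟩ := Ext.contravariant_sequence_exact₂ h.shortExact N x
    (@Subsingleton.elim _ hA _ _)
  rw [@Subsingleton.elim _ hC y 0, Ext.comp_zero]

lemma ext_covariant_right (h : IsShortExactSeq f g) {i : ℕ} (hB : Subsingleton (Ext N B i))
    (hA : Subsingleton (Ext N A (i + 1))) : Subsingleton (Ext N C i) := by
  refine subsingleton_of_forall_eq 0 fun x => ?_
  obtain ⟨y, rfl⟩ := Ext.covariant_sequence_exact₃ N h.shortExact x rfl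
    (@Subsingleton.elim _ hA _ _)
  rw [@Subsingleton.elim _ hB y 0, Ext.zero_comp]

lemma exists_extension (h : IsShortExactSeq f g) (hC : Subsingleton (Ext C N 1)) (φ : A →ₗ[R] N) :
    ∃ ψ : B →ₗ[R] N, ψ ∘ₗ f = φ := by
  obtain ⟨y, hy⟩ := Ext.contravariant_sequence_exact₁ h.shortExact N
    (Ext.mk₀ (ModuleCat.ofHom φ : A ⟶ N)) (add_comm 1 0) (@Subsingleton.elim _ hC _ _)
  obtain ⟨ψ, rfl⟩ := (Ext.mk₀_bijective _ _).2 y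
  rw [Ext.mk₀_comp_mk₀] at hy
  exact ⟨ψ.hom, congrArg ModuleCat.Hom.hom ((Ext.mk₀_bijective _ _).1 hy)⟩

lemma exists_lift (h : IsShortExactSeq f g) (hA : Subsingleton (Ext N A 1))
    (φ : N →ₗ[R] C) :
    ∃ ψ : N →ₗ[R] B, g ∘ₗ ψ = φ := by
  obtain ⟨y, hy⟩ := Ext.covariant_sequence_exact₃ N h.shortExact
    (Ext.mk₀ (ModuleCat.ofHom φ : N ⟶ C)) (zero_add 1) (@Subsingleton.elim _ hA _ _)
  obtain ⟨ψ, rfl⟩ := (Ext.mk₀_bijective _ _).2 y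
  rw [Ext.mk₀_comp_mk₀] at hy
  exact ⟨ψ.hom, congrArg ModuleCat.Hom.hom ((Ext.mk₀_bijective _ _).1 hy)⟩

lemma ext_one_of_exists_extension (h : IsShortExactSeq f g) (hB : Subsingleton (Ext B N 1))
    (hext : ∀ φ : A →ₗ[R] N, ∃ ψ : B →ₗ[R] N, ψ ∘ₗ f = φ) : Subsingleton (Ext C N 1) := by
  refine subsingleton_of_forall_eq 0 fun x => ?_
  obtain ⟨y, rfl⟩ := Ext.contravariant_sequence_exact₃ h.shortExact N x
    (@Subsingleton.elim _ hB _ _) (add_comm 1 0)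
  obtain ⟨φ, rfl⟩ := (Ext.mk₀_bijective _ _).2 y
  obtain ⟨ψ, hψ⟩ := hext φ.hom
  have hφ : φ = (ModuleCat.shortComplexOfCompEqZero f g h.comp_eq_zero).f ≫ ModuleCat.ofHom ψ :=
    ModuleCat.hom_ext hψ.symm
  rw [hφ, ← Ext.mk₀_comp_mk₀]
  exact h.shortExact.extClass_comp_assoc _

lemma ext_covariant_left (h : IsShortExactSeq f g) {i : ℕ} (hC : Subsingleton (Ext N C i))
    (hB : Subsingleton (Ext N B (i + 1))) : Subsingleton (Ext N A (i + 1)) := by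
  refine subsingleton_of_forall_eq 0 fun x => ?_
  obtain ⟨y, rfl⟩ := Ext.covariant_sequence_exact₁ N h.shortExact x
    (@Subsingleton.elim _ hB _ _) rfl
  rw [@Subsingleton.elim _ hC y 0, Ext.zero_comp]

lemma ext_one_of_exists_lift (h : IsShortExactSeq f g) (hB : Subsingleton (Ext N B 1))
    (hlift : ∀ φ : N →ₗ[R] C, ∃ ψ : N →ₗ[R] B, g ∘ₗ ψ = φ) : Subsingleton (Ext N A 1) := by
  refine subsingleton_of_forall_eq 0 fun x => ?_
  obtain ⟨y, rfl⟩ := Ext.covariant_sequence_exact₁ N h.shortExact x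
    (@Subsingleton.elim _ hB _ _) (zero_add 1)
  obtain ⟨φ, rfl⟩ := (Ext.mk₀_bijective _ _).2 y
  obtain ⟨ψ, hψ⟩ := hlift φ.hom
  have hφ : φ = ModuleCat.ofHom ψ ≫ (ModuleCat.shortComplexOfCompEqZero f g h.comp_eq_zero).g :=
    ModuleCat.hom_ext hψ.symm
  rw [hφ, ← Ext.mk₀_comp_mk₀, Ext.comp_assoc_of_second_deg_zero, h.shortExact.comp_extClass,
    Ext.comp_zero]

end IsShortExactSeq

/-- The pushout of two short exact sequences with the same left end. -/
lemma IsShortExactSeq.exists_pushout {A G L M N : ModuleCat.{u} R}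
    {ι : A →ₗ[R] G} {π : G →ₗ[R] M} (h : IsShortExactSeq ι π)
    {j : A →ₗ[R] L} {q : L →ₗ[R] N} (h' : IsShortExactSeq j q) :
    ∃ (P : ModuleCat.{u} R) (a : L →ₗ[R] P) (b : P →ₗ[R] M) (c : G →ₗ[R] P) (e : P →ₗ[R] N),
      IsShortExactSeq a b ∧ IsShortExactSeq c e := by
  let W : Submodule R (L × G) := LinearMap.range (j.prod (-ι))
  have hb : W ≤ LinearMap.ker (π ∘ₗ LinearMap.snd R L G) := by
    rintro _ ⟨x, rfl⟩
    simpa using LinearMap.congr_fun h.comp_eq_zero x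
  have he : W ≤ LinearMap.ker (q ∘ₗ LinearMap.fst R L G) := by
    rintro _ ⟨x, rfl⟩
    simpa using LinearMap.congr_fun h'.comp_eq_zero x
  refine ⟨ModuleCat.of R ((L × G) ⧸ W), W.mkQ ∘ₗ LinearMap.inl R L G, W.liftQ _ hb,
    W.mkQ ∘ₗ LinearMap.inr R L G, W.liftQ _ he, ⟨?_, ?_, ?_⟩, ⟨?_, ?_, ?_⟩⟩
  · refine (injective_iff_map_eq_zero _).2 fun x hx => ?_
    obtain ⟨y, hy⟩ := (Submodule.Quotient.mk_eq_zero W).1 hx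
    have h1 : j y = x := congrArg Prod.fst hy
    have h2 : -ι y = 0 := congrArg Prod.snd hy
    have h3 : y = 0 := h.inj (by rw [map_zero, ← neg_eq_zero, h2])
    rw [← h1, h3, map_zero]
  · intro m
    obtain ⟨y, rfl⟩ := h.surj m
    exact ⟨W.mkQ (0, y), rfl⟩
  · intro p
    obtain ⟨⟨x, y⟩, rfl⟩ := W.mkQ_surjective p
    constructor
    · intro hp
      obtain ⟨k, rfl⟩ := (h.exact y).1 hp
      refine ⟨x + j k, (Submodule.Quotient.eq W).2 ⟨k, ?_⟩⟩
      simp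
    · rintro ⟨z, hz⟩
      rw [← hz]
      exact map_zero π
  · refine (injective_iff_map_eq_zero _).2 fun x hx => ?_
    obtain ⟨y, hy⟩ := (Submodule.Quotient.mk_eq_zero W).1 hx
    have h1 : j y = 0 := congrArg Prod.fst hy
    have h2 : -ι y = x := congrArg Prod.snd hy
    have h3 : y = 0 := h'.inj (by rw [map_zero, h1])
    rw [← h2, h3, map_zero, neg_zero]
  · intro m
    obtain ⟨y, rfl⟩ := h'.surj m
    exact ⟨W.mkQ (y, 0), rfl⟩
  · intro p
    obtain ⟨⟨x, y⟩, rfl⟩ := W.mkQ_surjective p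
    constructor
    · intro hp
      obtain ⟨k, rfl⟩ := (h'.exact x).1 hp
      refine ⟨y + ι k, (Submodule.Quotient.eq W).2 ⟨-k, ?_⟩⟩
      simp
    · rintro ⟨z, hz⟩
      rw [← hz]
      exact map_zero q

/-- The third isomorphism theorem for a composite of two admissible monomorphisms. -/
lemma IsShortExactSeq.exists_quotient {L P M F G : ModuleCat.{u} R}
    {a : L →ₗ[R] P} {b : P →ₗ[R] M} (h : IsShortExactSeq a b)
    {e : P →ₗ[R] F} {c : F →ₗ[R] G} (h' : IsShortExactSeq e c) :
    ∃ (Q : ModuleCat.{u} R) (q : F →ₗ[R] Q) (s : M →ₗ[R] Q) (t : Q →ₗ[R] G),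
      IsShortExactSeq (e ∘ₗ a) q ∧ IsShortExactSeq s t := by
  let W : Submodule R F := LinearMap.range (e ∘ₗ a)
  obtain ⟨s, hs⟩ := h.exists_desc (W.mkQ ∘ₗ e) (LinearMap.ext fun x =>
    (Submodule.Quotient.mk_eq_zero W).2 ⟨x, rfl⟩)
  have hs' : ∀ p, s (b p) = W.mkQ (e p) := LinearMap.congr_fun hs
  have hW : W ≤ LinearMap.ker c := by
    rintro _ ⟨x, rfl⟩
    exact LinearMap.congr_fun h'.comp_eq_zero (a x)
  refine ⟨ModuleCat.of R (F ⧸ W), W.mkQ, s, W.liftQ c hW,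
    ⟨h'.inj.comp h.inj, W.mkQ_surjective, LinearMap.exact_map_mkQ_range _⟩, ⟨?_, ?_, ?_⟩⟩
  · refine (injective_iff_map_eq_zero _).2 fun m hm => ?_
    obtain ⟨p, rfl⟩ := h.surj m
    rw [hs'] at hm
    obtain ⟨x, hx⟩ := (Submodule.Quotient.mk_eq_zero W).1 hm
    rw [← h'.inj hx]
    exact LinearMap.congr_fun h.comp_eq_zero x
  · intro y
    obtain ⟨x, rfl⟩ := h'.surj y
    exact ⟨W.mkQ x, rfl⟩
  · intro y
    obtain ⟨x, rfl⟩ := W.mkQ_surjective y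
    constructor
    · intro hx
      obtain ⟨p, rfl⟩ := (h'.exact x).1 hx
      exact ⟨b p, hs' p⟩
    · rintro ⟨m, hm⟩
      obtain ⟨p, rfl⟩ := h.surj m
      rw [← hm, hs']
      exact LinearMap.congr_fun h'.comp_eq_zero p

end ShortExactSequences

section FlatModules

variable {R : Type u} [Ring R]

/-- The character module of a right module, as an object of the category of left modules. -/
abbrev leftCharacter (A : Type u) [AddCommGroup A] [Module Rᵐᵒᵖ A] : ModuleCat.{u} R :=
  ModuleCat.of R (CharacterModule A)

/-- The map of character modules induced by a map of right modules. -/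
abbrev leftCharacterMap {A B : Type u} [AddCommGroup A] [Module Rᵐᵒᵖ A] [AddCommGroup B]
    [Module Rᵐᵒᵖ B] (f : A →ₗ[Rᵐᵒᵖ] B) :
    leftCharacter (R := R) B →ₗ[R] leftCharacter (R := R) A :=
  characterMapLeft f

lemma IsShortExactSeq.leftCharacterMap {A B C : Type u} [AddCommGroup A] [Module Rᵐᵒᵖ A]
    [AddCommGroup B] [Module Rᵐᵒᵖ B] [AddCommGroup C] [Module Rᵐᵒᵖ C] {f : A →ₗ[Rᵐᵒᵖ] B}
    {g : B →ₗ[Rᵐᵒᵖ] C} (h : IsShortExactSeq f g) :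
    IsShortExactSeq (_root_.leftCharacterMap (R := R) g) (_root_.leftCharacterMap (R := R) f) where
  inj c c' hcc := by
    ext x
    obtain ⟨b, rfl⟩ := h.surj x
    exact DFunLike.congr_fun hcc b
  surj := (injective_iff_characters f.toAddMonoidHom).1 h.inj
  exact := (exact_iff_characters f.toAddMonoidHom g.toAddMonoidHom).1 h.exact

lemma isFlatMod_of_projective (P : ModuleCat.{u} R) [Module.Projective R P] : IsFlatMod R P := by
  rw [isFlatMod_iff]
  intro A B _ _ _ _ f hf φ
  exact Module.projective_lifting_property _ φ
    ((injective_iff_characters f.toAddMonoidHom).1 hf)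

lemma isFlatMod_of_subsingleton (P : ModuleCat.{u} R) [Subsingleton P] : IsFlatMod R P := by
  rw [isFlatMod_iff]
  intro A B _ _ _ _ f hf φ
  refine ⟨0, LinearMap.ext fun x => ?_⟩
  rw [Subsingleton.elim x 0, map_zero, map_zero]

/-- A right module is flat iff its character module is an injective left module. -/
lemma isFlatMod_op_iff_injective (E : ModuleCat.{u} Rᵐᵒᵖ) :
    IsFlatMod Rᵐᵒᵖ E ↔ Module.Injective R (CharacterModule E) := by
  rw [isFlatMod_iff_injective_characterModule]
  constructor
  · intro h
    refine ⟨fun X Y _ _ _ _ f hf g => ?_⟩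
    let : Module Rᵐᵒᵖᵐᵒᵖ X := Module.compHom X (RingEquiv.opOp R).symm.toRingHom
    let : Module Rᵐᵒᵖᵐᵒᵖ Y := Module.compHom Y (RingEquiv.opOp R).symm.toRingHom
    let f' : X →ₗ[Rᵐᵒᵖᵐᵒᵖ] Y := { f.toAddMonoidHom with map_smul' r x := f.map_smul _ x }
    let g' : X →ₗ[Rᵐᵒᵖᵐᵒᵖ] CharacterModule E :=
      { g.toAddMonoidHom with map_smul' r x := g.map_smul _ x }
    obtain ⟨k, hk⟩ := h.out f' hf g'
    exact ⟨{ k.toAddMonoidHom with map_smul' r y := k.map_smul (op (op r)) y }, hk⟩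
  · intro h
    refine ⟨fun X Y _ _ _ _ f hf g => ?_⟩
    let : Module R X := Module.compHom X (RingEquiv.opOp R).toRingHom
    let : Module R Y := Module.compHom Y (RingEquiv.opOp R).toRingHom
    let f' : X →ₗ[R] Y := { f.toAddMonoidHom with map_smul' r x := f.map_smul _ x }
    let g' : X →ₗ[R] CharacterModule E :=
      { g.toAddMonoidHom with map_smul' r x := g.map_smul _ x }
    obtain ⟨k, hk⟩ := h.out f' hf g'
    exact ⟨{ k.toAddMonoidHom with map_smul' r y := k.map_smul (unop (unop r)) y }, hk⟩

/-- The flat dimension of a right module is the injective dimension of its character module. -/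
lemma flatDimLE_op_iff_hasInjectiveDimensionLT (n : ℕ) (E : ModuleCat.{u} Rᵐᵒᵖ) :
    flatDimLE Rᵐᵒᵖ n E ↔ HasInjectiveDimensionLT (leftCharacter (R := R) E) (n + 1) := by
  induction n generalizing E with
  | zero =>
    rw [flatDimLE, isFlatMod_op_iff_injective, Module.injective_iff_injective_object,
      injective_iff_hasInjectiveDimensionLT_one]
  | succ n ih =>
    constructor
    · rintro ⟨K, F, ι, π, hι, hπ, hex, hF, hK⟩
      have hs := (IsShortExactSeq.leftCharacterMap (R := R) ⟨hι, hπ, hex⟩).shortExact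
      have : Injective (leftCharacter (R := R) F) :=
        (Module.injective_iff_injective_object R _).1 ((isFlatMod_op_iff_injective F).1 hF)
      exact (hs.hasInjectiveDimensionLT_X₃_iff n this).1 ((ih K).1 hK)
    · intro hE
      obtain ⟨K, F, ι, π, h, hF⟩ := exists_isShortExactSeq_projective E
      have hs := (IsShortExactSeq.leftCharacterMap (R := R) h).shortExact
      have hF' := isFlatMod_of_projective F
      have : Injective (leftCharacter (R := R) F) :=
        (Module.injective_iff_injective_object R _).1 ((isFlatMod_op_iff_injective F).1 hF')
      exact ⟨K, F, ι, π, h.inj, h.surj, h.exact, hF',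
        (ih K).2 ((hs.hasInjectiveDimensionLT_X₃_iff n this).2 hE)⟩

lemma ext_of_projective (P N : ModuleCat.{u} R) [Module.Projective R P] (i : ℕ) :
    Subsingleton (Ext P N (i + 1)) := by
  have : Projective P := (IsProjective.iff_projective P).1 inferInstance
  exact subsingleton_of_forall_eq 0 fun x => Ext.eq_zero_of_projective x

lemma ext_of_injective (M I : ModuleCat.{u} R) (hI : Module.Injective R I) (i : ℕ) :
    Subsingleton (Ext M I (i + 1)) := by
  have : Injective I := (Module.injective_iff_injective_object R _).1 hI
  exact subsingleton_of_forall_eq 0 fun x => Ext.eq_zero_of_injective x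

/-- `Ext` from a flat module into a character module vanishes. -/
lemma ext_characterModule_of_isFlatMod {L : ModuleCat.{u} R} (hL : IsFlatMod R L)
    (A : ModuleCat.{u} Rᵐᵒᵖ) (i : ℕ) :
    Subsingleton (Ext L (leftCharacter (R := R) A) (i + 1)) := by
  induction i generalizing A with
  | zero =>
    obtain ⟨X, P, f, g, h, hP⟩ := exists_isShortExactSeq_projective A
    have hP' := (isFlatMod_op_iff_injective P).1 (isFlatMod_of_projective P)
    exact (IsShortExactSeq.leftCharacterMap (R := R) h).ext_one_of_exists_lift L
      (ext_of_injective L _ hP' 0) ((isFlatMod_iff L).1 hL X P f h.inj)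
  | succ i ih =>
    obtain ⟨X, P, f, g, h, hP⟩ := exists_isShortExactSeq_projective A
    have hP' := (isFlatMod_op_iff_injective P).1 (isFlatMod_of_projective P)
    exact (IsShortExactSeq.leftCharacterMap (R := R) h).ext_covariant_left L (ih X)
      (ext_of_injective L _ hP' (i + 1))

lemma isFlatMod_of_ext {L : ModuleCat.{u} R}
    (hL : ∀ A : ModuleCat.{u} Rᵐᵒᵖ, Subsingleton (Ext L (leftCharacter (R := R) A) 1)) :
    IsFlatMod R L := by
  rw [isFlatMod_iff]
  intro A B _ _ _ _ f hf
  have h : IsShortExactSeq f (LinearMap.range f).mkQ :=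
    ⟨hf, Submodule.mkQ_surjective _, LinearMap.exact_map_mkQ_range f⟩
  exact (IsShortExactSeq.leftCharacterMap (R := R) h).exists_lift L
    (hL (ModuleCat.of Rᵐᵒᵖ (B ⧸ LinearMap.range f)))

lemma ext_characterModule_of_flatDimLE {d : ℕ} {L : ModuleCat.{u} R} (hL : flatDimLE R d L)
    (A : ModuleCat.{u} Rᵐᵒᵖ) (i : ℕ) :
    Subsingleton (Ext L (leftCharacter (R := R) A) (i + d + 1)) := by
  induction d generalizing L with
  | zero => exact ext_characterModule_of_isFlatMod hL A i
  | succ d ih =>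
    obtain ⟨K, F, ι, π, hι, hπ, hex, hF, hK⟩ := hL
    exact IsShortExactSeq.ext_right _ ⟨hι, hπ, hex⟩ (ih hK)
      (ext_characterModule_of_isFlatMod hF A _)

/-- Vanishing of `Ext` from `M` into the character modules of injective right modules. -/
def ExtCharacterVanishing (M : ModuleCat.{u} R) : Prop :=
  ∀ I : ModuleCat.{u} Rᵐᵒᵖ, Module.Injective Rᵐᵒᵖ I → ∀ i : ℕ,
    Subsingleton (Ext M (leftCharacter (R := R) I) (i + 1))

/-- A module of finite flat dimension with `Ext` vanishing against character modules of
injective modules is flat. -/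
lemma isFlatMod_of_flatDimLE {d : ℕ} {L : ModuleCat.{u} R} (hL : flatDimLE R d L)
    (hext : ExtCharacterVanishing L) : IsFlatMod R L := by
  have key : ∀ (k i : ℕ), d ≤ i + k → ∀ A : ModuleCat.{u} Rᵐᵒᵖ,
      Subsingleton (Ext L (leftCharacter (R := R) A) (i + 1)) := by
    intro k
    induction k with
    | zero =>
      intro i hi A
      obtain ⟨j, rfl⟩ := Nat.exists_eq_add_of_le' hi
      exact ext_characterModule_of_flatDimLE hL A j
    | succ k ih =>
      intro i hi A
      obtain ⟨E, C, f, g, h, hE⟩ := exists_isShortExactSeq_injective A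
      exact (IsShortExactSeq.leftCharacterMap (R := R) h).ext_covariant_right L (hext E hE i)
        (ih (i + 1) (by omega) C)
  exact isFlatMod_of_ext (key d 0 (by omega))

end FlatModules

section GorensteinFlat

variable {R : Type u} [Ring R]

/-- `FlatStep M M'` says that there is a short exact sequence `0 → M → F → M' → 0` with `F` flat
that stays exact after tensoring with injective right modules. -/
def FlatStep (M M' : ModuleCat.{u} R) : Prop :=
  ∃ (F : ModuleCat.{u} R) (ι : M →ₗ[R] F) (π : F →ₗ[R] M'), IsShortExactSeq ι π ∧
    IsFlatMod R F ∧ ∀ I : ModuleCat.{u} Rᵐᵒᵖ, Module.Injective Rᵐᵒᵖ I →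
      ∀ φ : M →ₗ[R] leftCharacter (R := R) I, ∃ ψ : F →ₗ[R] leftCharacter (R := R) I, ψ ∘ₗ ι = φ

lemma FlatStep.of_equiv {M N M' : ModuleCat.{u} R} (h : FlatStep N M') (e : M ≃ₗ[R] N) :
    FlatStep M M' := by
  obtain ⟨F, ι, π, hs, hF, hI⟩ := h
  refine ⟨F, ι ∘ₗ e.toLinearMap, π, ⟨hs.inj.comp e.injective, hs.surj, fun x => ?_⟩, hF,
    fun I hinj φ => ?_⟩
  · rw [hs.exact x]
    exact e.surjective.range_comp ι ▸ Iff.rfl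
  · obtain ⟨ψ, hψ⟩ := hI I hinj (φ ∘ₗ e.symm.toLinearMap)
    exact ⟨ψ, by rw [← LinearMap.comp_assoc, hψ]; ext x; simp⟩

/-- The modules occurring in a two-sided infinite chain of flat steps are Gorenstein flat. -/
lemma isGorensteinFlat_of_chain {Z : ℤ → ModuleCat.{u} R} (hZ : ∀ n, FlatStep (Z n) (Z (n + 1)))
    {M : ModuleCat.{u} R} (m : ℤ) (e : M ≃ₗ[R] Z m) : IsGorensteinFlat R M := by
  obtain ⟨k, rfl⟩ : ∃ k, m = k + (0 + 1) := ⟨m - 1, by ring⟩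
  have hstep : ∀ n, FlatStep (Z (k + n)) (Z (k + (n + 1))) := fun n => by
    rw [← add_assoc]
    exact hZ (k + n)
  choose F ι π hs hF hI using hstep
  let d : ∀ n, F n →ₗ[R] F (n + 1) := fun n => ι (n + 1) ∘ₗ π n
  have hd : ∀ n x, d n x = ι (n + 1) (π n x) := fun _ _ => rfl
  have hexact : ∀ n, Function.Exact (d n) (d (n + 1)) := by
    intro n y
    rw [hd, map_eq_zero_iff _ (hs (n + 1 + 1)).inj, (hs (n + 1)).exact y]
    constructor
    · rintro ⟨z, rfl⟩
      obtain ⟨x, rfl⟩ := (hs n).surj z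
      exact ⟨x, rfl⟩
    · rintro ⟨x, rfl⟩
      exact ⟨_, rfl⟩
  refine ⟨F, d, hF, hexact, ⟨?_⟩, fun I _ _ hinj n => ?_⟩
  · have hr : LinearMap.range (d 0) = LinearMap.range (ι (0 + 1)) :=
      LinearMap.range_comp_of_range_eq_top _ (LinearMap.range_eq_top.2 (hs 0).surj)
    exact e.trans ((LinearEquiv.ofInjective _ (hs (0 + 1)).inj).trans
      (LinearEquiv.ofEq _ _ hr.symm))
  · rw [NTensor.rmap_exact_iff]
    intro ψ
    constructor
    · intro hψ
      obtain ⟨θ, hθ⟩ := (hs (n + 1)).exists_desc ψ (LinearMap.ext fun z => by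
        obtain ⟨x, rfl⟩ := (hs n).surj z
        exact LinearMap.congr_fun hψ x)
      obtain ⟨χ, hχ⟩ := hI (n + 1 + 1) (ModuleCat.of Rᵐᵒᵖ I) hinj θ
      refine ⟨χ, ?_⟩
      rw [← hθ, ← hχ]
      rfl
    · rintro ⟨χ, rfl⟩
      rw [LinearMap.comp_assoc, (hexact n).linearMap_comp_eq_zero, LinearMap.comp_zero]

lemma IsGorensteinFlat.exists_chain {M : ModuleCat.{u} R} (hM : IsGorensteinFlat R M) :
    ∃ Z : ℤ → ModuleCat.{u} R, (∀ n, FlatStep (Z n) (Z (n + 1))) ∧ Nonempty (M ≃ₗ[R] Z 0) := by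
  obtain ⟨F, d, hF, hd, e, hI⟩ := hM
  refine ⟨fun n => ModuleCat.of R (LinearMap.range (d n)), fun n => ?_, e⟩
  obtain ⟨k, rfl⟩ : ∃ k, n = k + 1 := ⟨n - 1, by ring⟩
  refine ⟨F (k + 1 + 1), (LinearMap.range (d (k + 1))).subtype, (d (k + 1 + 1)).rangeRestrict,
    ⟨Subtype.val_injective, LinearMap.surjective_rangeRestrict _, fun y => ?_⟩, hF _,
    fun I hinj φ => ?_⟩
  · have hy := hd (k + 1) y
    rw [← Subtype.coe_inj]
    exact hy.trans ⟨fun ⟨x, hx⟩ => ⟨⟨y, x, hx⟩, rfl⟩, fun ⟨x, hx⟩ => hx ▸ x.2⟩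
  · obtain ⟨χ, hχ⟩ := ((NTensor.rmap_exact_iff _ _).1 (hI I hinj k)
      (φ ∘ₗ (d (k + 1)).rangeRestrict)).1 (LinearMap.ext fun x => by
        have : (d (k + 1)).rangeRestrict (d k x) = 0 :=
          Subtype.ext ((hd k).apply_apply_eq_zero x)
        exact (congrArg φ this).trans (map_zero φ))
    refine ⟨χ, LinearMap.ext fun y => ?_⟩
    obtain ⟨x, rfl⟩ := LinearMap.surjective_rangeRestrict _ y
    exact LinearMap.congr_fun hχ x

lemma IsGorensteinFlat.exists_flatStep {M : ModuleCat.{u} R} (hM : IsGorensteinFlat R M) :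
    ∃ M', FlatStep M M' ∧ IsGorensteinFlat R M' := by
  obtain ⟨Z, hZ, ⟨e⟩⟩ := hM.exists_chain
  exact ⟨Z (0 + 1), (hZ 0).of_equiv e, isGorensteinFlat_of_chain hZ _ (LinearEquiv.refl R _)⟩

lemma extCharacterVanishing_of_isFlatMod {L : ModuleCat.{u} R} (hL : IsFlatMod R L) :
    ExtCharacterVanishing L :=
  fun I _ i => ext_characterModule_of_isFlatMod hL I i

lemma IsShortExactSeq.extCharacterVanishing_left {A B C : ModuleCat.{u} R} {f : A →ₗ[R] B}
    {g : B →ₗ[R] C} (h : IsShortExactSeq f g) (hB : ExtCharacterVanishing B)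
    (hC : ExtCharacterVanishing C) : ExtCharacterVanishing A :=
  fun I hI i => h.ext_left _ (hB I hI i) (hC I hI (i + 1))

lemma IsGorensteinFlat.extCharacterVanishing {M : ModuleCat.{u} R} (hM : IsGorensteinFlat R M) :
    ExtCharacterVanishing M := by
  obtain ⟨Z, hZ, ⟨e⟩⟩ := hM.exists_chain
  have key : ∀ I : ModuleCat.{u} Rᵐᵒᵖ, Module.Injective Rᵐᵒᵖ I → ∀ i n,
      Subsingleton (Ext (Z (n + 1)) (leftCharacter (R := R) I) (i + 1)) := by
    intro I hinj i
    induction i with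
    | zero =>
      intro n
      obtain ⟨F, ι, π, hs, hF, hI⟩ := hZ n
      exact hs.ext_one_of_exists_extension _ (ext_characterModule_of_isFlatMod hF I 0) (hI I hinj)
    | succ i ih =>
      intro n
      obtain ⟨F, ι, π, hs, hF, -⟩ := hZ n
      obtain ⟨k, rfl⟩ : ∃ k, n = k + 1 := ⟨n - 1, by ring⟩
      exact hs.ext_right _ (ih k) (ext_characterModule_of_isFlatMod hF I _)
  obtain ⟨F, ι, π, hs, hF, -⟩ := (hZ 0).of_equiv e
  exact hs.extCharacterVanishing_left (extCharacterVanishing_of_isFlatMod hF)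
    fun I hinj i => key I hinj i 0

lemma IsShortExactSeq.flatStep {K L G : ModuleCat.{u} R} {f : K →ₗ[R] L} {g : L →ₗ[R] G}
    (h : IsShortExactSeq f g) (hL : IsFlatMod R L) (hG : ExtCharacterVanishing G) :
    FlatStep K G :=
  ⟨L, f, g, h, hL, fun I hI => h.exists_extension _ (hG I hI 0)⟩

lemma ExtCharacterVanishing.exists_flatStep {N : ModuleCat.{u} R} (hN : ExtCharacterVanishing N) :
    ∃ N', FlatStep N' N ∧ ExtCharacterVanishing N' := by
  obtain ⟨K, P, f, g, h, hP⟩ := exists_isShortExactSeq_projective N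
  have hP' := isFlatMod_of_projective P
  exact ⟨K, h.flatStep hP' hN,
    h.extCharacterVanishing_left (extCharacterVanishing_of_isFlatMod hP') hN⟩

/-- The kernel of a surjection from a flat module to a Gorenstein flat module is
Gorenstein flat. -/
lemma IsShortExactSeq.isGorensteinFlat_left {K L G : ModuleCat.{u} R} {f : K →ₗ[R] L}
    {g : L →ₗ[R] G} (h : IsShortExactSeq f g) (hL : IsFlatMod R L) (hG : IsGorensteinFlat R G) :
    IsGorensteinFlat R K := by
  have hK := h.extCharacterVanishing_left (extCharacterVanishing_of_isFlatMod hL)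
    hG.extCharacterVanishing
  choose next hnext hnextG using
    fun M : {M : ModuleCat.{u} R // IsGorensteinFlat R M} => M.2.exists_flatStep
  choose prev hprev hprevE using
    fun M : {M : ModuleCat.{u} R // ExtCharacterVanishing M} => M.2.exists_flatStep
  let a : ℕ → {M : ModuleCat.{u} R // IsGorensteinFlat R M} :=
    fun k => Nat.rec ⟨G, hG⟩ (fun _ M => ⟨next M, hnextG M⟩) k
  let b : ℕ → {M : ModuleCat.{u} R // ExtCharacterVanishing M} :=
    fun k => Nat.rec ⟨K, hK⟩ (fun _ M => ⟨prev M, hprevE M⟩) k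
  let Z : ℤ → ModuleCat.{u} R
    | Int.ofNat k => (a k).1
    | Int.negSucc k => (b k).1
  refine isGorensteinFlat_of_chain (Z := Z) (fun n => ?_) (Int.negSucc 0) (LinearEquiv.refl R K)
  match n with
  | Int.ofNat k => exact hnext (a k)
  | Int.negSucc 0 => exact h.flatStep hL hG.extCharacterVanishing
  | Int.negSucc (k + 1) => exact hprev (b k)

lemma isGorensteinFlat_punit : IsGorensteinFlat R (ModuleCat.of R PUnit.{u + 1}) := by
  refine isGorensteinFlat_of_chain (Z := fun _ => ModuleCat.of R PUnit.{u + 1}) (fun _ => ?_) 0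
    (LinearEquiv.refl R _)
  refine ⟨ModuleCat.of R PUnit.{u + 1}, LinearMap.id, 0,
    ⟨Function.injective_id, fun x => ⟨x, rfl⟩, fun x => ⟨fun _ => ⟨x, rfl⟩, fun _ => rfl⟩⟩,
    isFlatMod_of_subsingleton _, fun I _ φ => ⟨φ, rfl⟩⟩

lemma IsFlatMod.isGorensteinFlat {L : ModuleCat.{u} R} (hL : IsFlatMod R L) :
    IsGorensteinFlat R L :=
  IsShortExactSeq.isGorensteinFlat_left (f := LinearMap.id)
    (g := (0 : L →ₗ[R] ModuleCat.of R PUnit.{u + 1}))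
    ⟨Function.injective_id, fun _ => ⟨0, rfl⟩, fun x => ⟨fun _ => ⟨x, rfl⟩, fun _ => rfl⟩⟩ hL
    isGorensteinFlat_punit

lemma ext_characterModule_of_gflatDimLE {m : ℕ} {M : ModuleCat.{u} R} (hM : gflatDimLE R m M)
    (I : ModuleCat.{u} Rᵐᵒᵖ) (hI : Module.Injective Rᵐᵒᵖ I) (i : ℕ) :
    Subsingleton (Ext M (leftCharacter (R := R) I) (i + m + 1)) := by
  induction m generalizing M with
  | zero => exact IsGorensteinFlat.extCharacterVanishing hM I hI i
  | succ m ih =>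
    obtain ⟨K, G, ι, π, hι, hπ, hex, hG, hK⟩ := hM
    exact IsShortExactSeq.ext_right _ ⟨hι, hπ, hex⟩ (ih hK) (hG.extCharacterVanishing I hI _)

/-- Over a left GF-closed ring, a module of finite Gorenstein flat dimension embeds into a module
of the same flat dimension with Gorenstein flat cokernel. -/
lemma IsGFClosed.exists_flatDimLE (h : IsGFClosed R) {m : ℕ} {M : ModuleCat.{u} R}
    (hM : gflatDimLE R m M) :
    ∃ (L G : ModuleCat.{u} R) (f : M →ₗ[R] L) (g : L →ₗ[R] G),
      IsShortExactSeq f g ∧ flatDimLE R m L ∧ IsGorensteinFlat R G := by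
  induction m generalizing M with
  | zero =>
    obtain ⟨M', ⟨F, ι, π, hs, hF, -⟩, hM'⟩ := IsGorensteinFlat.exists_flatStep hM
    exact ⟨F, M', ι, π, hs, hF, hM'⟩
  | succ m ih =>
    obtain ⟨K, G, ι, π, hι, hπ, hex, hG, hK⟩ := hM
    obtain ⟨L, N, j, q, hjq, hL, hN⟩ := ih hK
    obtain ⟨P, a, b, c, e, hab, hce⟩ :=
      IsShortExactSeq.exists_pushout (ι := ι) (π := π) ⟨hι, hπ, hex⟩ hjq
    have hP := h G P N c e hce.inj hce.surj hce.exact hG hN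
    obtain ⟨G', ⟨F, s, t, hst, hF, -⟩, hG'⟩ := hP.exists_flatStep
    obtain ⟨Q, q', s', t', hq, hs'⟩ := hab.exists_quotient hst
    exact ⟨Q, G', s', t', hs', ⟨L, F, s ∘ₗ a, q', hq.inj, hq.surj, hq.exact, hF, hL⟩, hG'⟩

/-- Over a left GF-closed ring, a module of finite Gorenstein flat dimension is Gorenstein flat as
soon as its `Ext` against character modules of injective modules vanishes. -/
lemma IsGFClosed.isGorensteinFlat (h : IsGFClosed R) {m : ℕ} {M : ModuleCat.{u} R}
    (hM : gflatDimLE R m M) (hext : ExtCharacterVanishing M) : IsGorensteinFlat R M := by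
  obtain ⟨L, G, f, g, hfg, hL, hG⟩ := h.exists_flatDimLE hM
  exact hfg.isGorensteinFlat_left (isFlatMod_of_flatDimLE hL fun I hI i =>
    hfg.ext_mid _ (hext I hI i) (hG.extCharacterVanishing I hI i)) hG

lemma exists_nat_of_sInf_le {P : ℕ → Prop} {d : ℕ∞} (hd : d ≠ ⊤)
    (h : sInf {e : ℕ∞ | ∃ n : ℕ, e = n ∧ P n} ≤ d) : ∃ m : ℕ, (m : ℕ∞) ≤ d ∧ P m := by
  have hne : {e : ℕ∞ | ∃ n : ℕ, e = n ∧ P n}.Nonempty := by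
    by_contra hempty
    rw [Set.not_nonempty_iff_eq_empty] at hempty
    rw [hempty, sInf_empty, top_le_iff] at h
    exact hd h
  obtain ⟨m, hm, hP⟩ := csInf_mem hne
  exact ⟨m, hm ▸ h, hP⟩

/-- Over a left GF-closed ring of finite left weak Gorenstein global dimension, the Gorenstein
flat dimension is detected by `Ext` against character modules of injective modules. -/
lemma IsGFClosed.gflatDimLE_of_ext (h : IsGFClosed R) (hfin : gorensteinWeakGlobalDim R ≠ ⊤)
    {n : ℕ} {M : ModuleCat.{u} R}
    (hM : ∀ I : ModuleCat.{u} Rᵐᵒᵖ, Module.Injective Rᵐᵒᵖ I → ∀ i : ℕ,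
      Subsingleton (Ext M (leftCharacter (R := R) I) (i + n + 1))) :
    gflatDimLE R n M := by
  induction n generalizing M with
  | zero =>
    obtain ⟨m, -, hm⟩ := exists_nat_of_sInf_le hfin (le_iSup (gflatDim R) M)
    exact h.isGorensteinFlat hm hM
  | succ n ih =>
    obtain ⟨K, P, f, g, hs, hP⟩ := exists_isShortExactSeq_projective M
    exact ⟨K, P, f, g, hs.inj, hs.surj, hs.exact, (isFlatMod_of_projective P).isGorensteinFlat,
      ih fun I hI i => hs.ext_left _ (ext_of_projective P _ _) (hM I hI i)⟩

end GorensteinFlat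

/-- **Lemma 2.4 (1 ⇔ 4).**  If `R` is a left GF-closed ring with `l.Gwdim(R) < ∞` and `n` is a
positive integer, then `l.Gwdim(R) ≤ n` iff `fd_R(E) ≤ n` for every injective right
`R`-module `E`. -/
theorem gorensteinWeakGlobalDim_le_iff_flatDim_injective_le (R : Type u) [Ring R]
    (h : IsGFClosed R) (hfin : gorensteinWeakGlobalDim R ≠ ⊤) (n : ℕ) (hn : 0 < n) :
    gorensteinWeakGlobalDim R ≤ (n : ℕ∞) ↔
      ∀ E : ModuleCat.{u} Rᵐᵒᵖ, Module.Injective Rᵐᵒᵖ ↥E → flatDim Rᵐᵒᵖ E ≤ (n : ℕ∞) := by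
  constructor
  · intro hdim E hE
    have hinj : HasInjectiveDimensionLT (leftCharacter (R := R) E) (n + 1) := by
      refine hasInjectiveDimensionLT_of_enoughProjectives _ _ fun M => ?_
      obtain ⟨m, hm, hM⟩ := exists_nat_of_sInf_le (ENat.natCast_ne_top n)
        ((le_iSup (gflatDim R) M).trans hdim)
      obtain ⟨i, rfl⟩ := Nat.exists_eq_add_of_le' (Nat.cast_le.1 hm)
      exact ext_characterModule_of_gflatDimLE hM E hE i
    exact sInf_le ⟨n, rfl, (flatDimLE_op_iff_hasInjectiveDimensionLT n E).2 hinj⟩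
  · refine fun hE => iSup_le fun M => sInf_le ⟨n, rfl, h.gflatDimLE_of_ext hfin fun I hI i => ?_⟩
    obtain ⟨m, hm, hmI⟩ := exists_nat_of_sInf_le (ENat.natCast_ne_top n) (hE I hI)
    have := (flatDimLE_op_iff_hasInjectiveDimensionLT m I).1 hmI
    have hmn : m ≤ n := Nat.cast_le.1 hm
    exact HasInjectiveDimensionLT.subsingleton _ (m + 1) _ (by omega) M
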